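/- arXiv:0902.2235 — 2 statements merged into one kernel-verified Lean document; each statement's English description precedes it below -/
import Mathlib

section
/- Let R = F((z)) and let C, C̄ ⊆ R^n be k-dimensional R-codes, and let φ : C → C̄ be an R-isometry which is delay-preserving, i.e. del(φ(v)) = del(v) for all nonzero v ∈ C. Then the polynomial codes C_pol = C ∩ F[z]^n and C̄_pol = C̄ ∩ F[z]^n are z-monomially equivalent, i.e. there exists a z-monomial matrix M ∈ F(z)^{n×n} such that C̄_pol = {vM : v ∈ C_pol}. -/
open Matrix Polynomial

variable {F : Type*} [Field F]

/-- A polynomial matrix is basic if its evaluation at every point of the algebraic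
closure has full row rank. -/
def IsBasic {k n : ℕ} (G : Matrix (Fin k) (Fin n) (Polynomial F)) : Prop :=
  ∀ lam : AlgebraicClosure F, (G.map fun p => (Polynomial.aeval lam) p).rank = k

/-- A `z`-monomial matrix over the rational function field `F(z)`:
permutation times `diag (α_i z^{μ_i})` with `α_i ∈ F*`, `μ_i ∈ ℤ`. -/
def IsZMonomial {n : ℕ} (M : Matrix (Fin n) (Fin n) (RatFunc F)) : Prop :=
  ∃ (σ : Equiv.Perm (Fin n)) (α : Fin n → Fˣ) (μ : Fin n → ℤ),
    ∀ i j, M i j =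
      if σ i = j then algebraMap F (RatFunc F) (α j) * (RatFunc.X : RatFunc F) ^ (μ j) else 0

/-- The weight of a Laurent series row vector. -/
noncomputable def wtL {n : ℕ} (v : Fin n → LaurentSeries F) : ℕ∞ :=
  ∑ i, ((v i).support).encard

/-- The delay of a Laurent series row vector. -/
noncomputable def delL {n : ℕ} (v : Fin n → LaurentSeries F) : ℤ :=
  sInf {t : ℤ | ∃ i, (v i).coeff t ≠ 0}

/-- The Laurent series code generated by a polynomial encoder `G`. -/
def codeOfLS {k n : ℕ} (G : Matrix (Fin k) (Fin n) (Polynomial F)) :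
    Set (Fin n → LaurentSeries F) :=
  Set.range fun u : Fin k → LaurentSeries F =>
    u ᵥ* (G.map fun p => algebraMap (Polynomial F) (LaurentSeries F) p)

/-- A `k`-dimensional code over the Laurent series field. -/
def IsLSCode {n : ℕ} (k : ℕ) (C : Submodule (LaurentSeries F) (Fin n → LaurentSeries F)) :
    Prop :=
  ∃ G : Matrix (Fin k) (Fin n) (Polynomial F),
    IsBasic G ∧ (C : Set (Fin n → LaurentSeries F)) = codeOfLS G


/-- A nonzero functional on a finite vector space has a kernel of index the cardinality of the
field. -/
theorem Module.Dual.card_ker_mul_card {V : Type*} [AddCommGroup V] [Module F V]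
    {f : Module.Dual F V} (hf : f ≠ 0) :
    Nat.card (LinearMap.ker f) * Nat.card F = Nat.card V := by
  have e := LinearMap.quotKerEquivOfSurjective f (LinearMap.surjective hf)
  rw [Submodule.card_eq_card_quotient_mul_card (LinearMap.ker f), Nat.card_congr e.toEquiv,
    mul_comm]

theorem Module.Dual.card_ne_zero_mul_card [Finite F] {V : Type*} [AddCommGroup V] [Module F V]
    [Fintype V] [DecidableEq F] {f : Module.Dual F V} (hf : f ≠ 0) :
    (Finset.univ.filter fun v => f v ≠ 0).card * Nat.card F =
      Nat.card V * (Nat.card F - 1) := by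
  have h1 := Module.Dual.card_ker_mul_card hf
  have h2 : Nat.card (LinearMap.ker f) = (Finset.univ.filter fun v => f v = 0).card := by
    rw [← Fintype.card_subtype, ← Nat.card_eq_fintype_card]
    exact Nat.card_congr (Equiv.subtypeEquivRight fun v => LinearMap.mem_ker)
  have h3 := Finset.card_filter_add_card_filter_not (s := (Finset.univ : Finset V))
    (fun v => f v = 0)
  rw [← h2, Finset.card_univ, ← Nat.card_eq_fintype_card] at h3
  rw [Nat.mul_sub, mul_one, ← h1, h1, ← h3, add_mul, h1, h3, Nat.add_sub_cancel_left]

theorem sum_card_functionals_ne_zero [Finite F] {V X : Type*} [AddCommGroup V] [Module F V]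
    [Fintype V] [DecidableEq F] [DecidableEq (Module.Dual F V)] (S : Finset X)
    (L : X → Module.Dual F V) :
    (∑ v, (S.filter fun x => L x v ≠ 0).card) * Nat.card F =
      (S.filter fun x => L x ≠ 0).card * (Nat.card V * (Nat.card F - 1)) := by
  have := Finset.sum_card_bipartiteAbove_eq_sum_card_bipartiteBelow
    (s := (Finset.univ : Finset V)) (t := S) (fun v x => L x v ≠ 0)
  simp only [Finset.bipartiteAbove, Finset.bipartiteBelow] at this
  rw [this, Finset.sum_mul, Finset.card_filter, Finset.sum_mul]
  refine Finset.sum_congr rfl fun x _ => ?_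
  by_cases h : L x = 0
  · simp [h]
  · rw [Module.Dual.card_ne_zero_mul_card h]
    simp [h]

theorem finite_and_sum_ncard_functionals_ne_zero [Finite F] {A X : Type*} [AddCommGroup A]
    [Module F A] (L : X → Module.Dual F A) (hL : ∀ v, {x | L x v ≠ 0}.Finite)
    (W : Submodule F A) [Fintype W] :
    {x | ∃ v ∈ W, L x v ≠ 0}.Finite ∧
    (∑ v : W, {x | L x v ≠ 0}.ncard) * Nat.card F =
      {x | ∃ v ∈ W, L x v ≠ 0}.ncard * (Nat.card W * (Nat.card F - 1)) := by
  classical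
  have hfin : {x | ∃ v ∈ W, L x v ≠ 0}.Finite := by
    have : {x | ∃ v ∈ W, L x v ≠ 0} = ⋃ v : W, {x | L x v ≠ 0} := by
      ext; simp
    rw [this]
    exact Set.finite_iUnion fun v => hL v
  refine ⟨hfin, ?_⟩
  have := sum_card_functionals_ne_zero hfin.toFinset (fun x => (L x).domRestrict W)
  convert this using 2
  · refine Finset.sum_congr rfl fun v _ => ?_
    rw [← Set.ncard_coe_finset]
    congr 1
    ext x
    refine Iff.trans ?_ (Finset.mem_coe.trans Finset.mem_filter).symm
    simp only [Set.Finite.mem_toFinset, Set.mem_ofPred_eq, LinearMap.domRestrict_apply]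
    exact ⟨fun hx => ⟨⟨v, v.2, hx⟩, hx⟩, fun hx => hx.2⟩
  · rw [← Set.ncard_coe_finset]
    congr 1
    ext x
    simp only [Finset.mem_coe, Finset.mem_filter, Set.Finite.mem_toFinset, Set.mem_ofPred_eq]
    refine ⟨fun hx => ⟨hx, fun h0 => ?_⟩, fun hx => hx.1⟩
    obtain ⟨v, hv, hne⟩ := hx
    exact hne (by simpa using LinearMap.congr_fun h0 ⟨v, hv⟩)

/-- Two families of functionals that vanish equally often at each vector contain equally many
functionals that are nonzero on a given finite subspace. -/
theorem ncard_exists_ne_zero_eq [Finite F] {A X Y : Type*} [AddCommGroup A] [Module F A]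
    (L : X → Module.Dual F A) (L' : Y → Module.Dual F A)
    (hL : ∀ v, {x | L x v ≠ 0}.Finite) (hL' : ∀ v, {y | L' y v ≠ 0}.Finite)
    (h : ∀ v, {x | L x v ≠ 0}.ncard = {y | L' y v ≠ 0}.ncard)
    (W : Submodule F A) [Finite W] :
    {x | ∃ v ∈ W, L x v ≠ 0}.ncard = {y | ∃ v ∈ W, L' y v ≠ 0}.ncard := by
  have := Fintype.ofFinite W
  have h2 := (finite_and_sum_ncard_functionals_ne_zero L hL W).2
  have h3 := (finite_and_sum_ncard_functionals_ne_zero L' hL' W).2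
  simp only [h] at h2
  rw [h2] at h3
  refine Nat.eq_of_mul_eq_mul_right ?_ h3
  have : 1 < Nat.card F := Finite.one_lt_card
  exact Nat.mul_pos Nat.card_pos (by omega)

theorem exists_finite_test_set {A X : Type*} [AddCommGroup A] [Module F A]
    (L : X → Module.Dual F A) (K : Submodule F A) (v₀ : A) (hL : {x | L x v₀ ≠ 0}.Finite) :
    ∃ T : Set A, T.Finite ∧ T ⊆ K ∧ ∀ x, L x v₀ ≠ 0 → T ⊆ LinearMap.ker (L x) →
      K ≤ LinearMap.ker (L x) := by
  have : ∀ x, ∃ a ∈ K, L x a = 0 → K ≤ LinearMap.ker (L x) := by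
    intro x
    by_cases hx : K ≤ LinearMap.ker (L x)
    · exact ⟨0, K.zero_mem, fun _ => hx⟩
    · obtain ⟨a, ha, hne⟩ := SetLike.not_le_iff_exists.mp hx
      exact ⟨a, ha, fun h0 => (hne (by simpa using h0)).elim⟩
  choose a ha ha' using this
  refine ⟨a '' {x | L x v₀ ≠ 0}, hL.image a, ?_, ?_⟩
  · rintro _ ⟨x, -, rfl⟩
    exact ha x
  · intro x hx hT
    exact ha' x (LinearMap.mem_ker.mp (hT ⟨x, hx, rfl⟩))

theorem setOf_le_ker_eq_sdiff {A X : Type*} [AddCommGroup A] [Module F A]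
    (L : X → Module.Dual F A) {K : Submodule F A} {v₀ : A} {T : Set A} (hTK : T ⊆ K)
    (hT : ∀ x, L x v₀ ≠ 0 → T ⊆ LinearMap.ker (L x) → K ≤ LinearMap.ker (L x)) :
    {x | L x v₀ ≠ 0 ∧ K ≤ LinearMap.ker (L x)} =
      {x | ∃ v ∈ Submodule.span F (insert v₀ T), L x v ≠ 0} \
        {x | ∃ v ∈ Submodule.span F T, L x v ≠ 0} := by
  ext x
  simp only [Set.mem_ofPred_eq, Set.mem_sdiff, not_exists, not_and, not_not]
  constructor
  · rintro ⟨hx, hK⟩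
    exact ⟨⟨v₀, Submodule.subset_span (Set.mem_insert _ _), hx⟩,
      fun v hv => hK (Submodule.span_le.mpr hTK hv)⟩
  · rintro ⟨⟨v, hv, hne⟩, h0⟩
    have hker : T ⊆ LinearMap.ker (L x) := fun w hw => h0 w (Submodule.subset_span hw)
    have hx : L x v₀ ≠ 0 := fun hx =>
      hne (Submodule.span_le.mpr (Set.insert_subset (LinearMap.mem_ker.mpr hx) hker) hv)
    exact ⟨hx, hT x hx hker⟩

/-- Two families of functionals that vanish equally often at each vector contain equally many
functionals that vanish on a given subspace and not at a given vector. -/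
theorem ncard_le_ker_eq [Finite F] {A X Y : Type*} [AddCommGroup A] [Module F A]
    (L : X → Module.Dual F A) (L' : Y → Module.Dual F A)
    (hL : ∀ v, {x | L x v ≠ 0}.Finite) (hL' : ∀ v, {y | L' y v ≠ 0}.Finite)
    (h : ∀ v, {x | L x v ≠ 0}.ncard = {y | L' y v ≠ 0}.ncard)
    (K : Submodule F A) (v₀ : A) :
    {x | L x v₀ ≠ 0 ∧ K ≤ LinearMap.ker (L x)}.ncard =
      {y | L' y v₀ ≠ 0 ∧ K ≤ LinearMap.ker (L' y)}.ncard := by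
  obtain ⟨T, hT, hTK, hTL⟩ := exists_finite_test_set L K v₀ (hL v₀)
  obtain ⟨T', hT', hTK', hTL'⟩ := exists_finite_test_set L' K v₀ (hL' v₀)
  have hfin : (T ∪ T').Finite := hT.union hT'
  have hW : Submodule.span F (T ∪ T') ≤ Submodule.span F (insert v₀ (T ∪ T')) :=
    Submodule.span_mono (Set.subset_insert _ _)
  have : Finite (Submodule.span F (T ∪ T')) := by
    have := Module.Finite.span_of_finite F hfin
    exact Module.finite_of_finite F
  have : Finite (Submodule.span F (insert v₀ (T ∪ T'))) := by
    have := Module.Finite.span_of_finite F (hfin.insert v₀)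
    exact Module.finite_of_finite F
  have hsub := Set.union_subset hTK hTK'
  rw [setOf_le_ker_eq_sdiff L hsub fun x hx h => hTL x hx (Set.subset_union_left.trans h),
    setOf_le_ker_eq_sdiff L' hsub fun x hx h => hTL' x hx (Set.subset_union_right.trans h)]
  have := Fintype.ofFinite (Submodule.span F (T ∪ T'))
  rw [Set.ncard_sdiff _ (finite_and_sum_ncard_functionals_ne_zero L hL _).1,
    Set.ncard_sdiff _ (finite_and_sum_ncard_functionals_ne_zero L' hL' _).1,
    ncard_exists_ne_zero_eq L L' hL hL' h, ncard_exists_ne_zero_eq L L' hL hL' h]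
  all_goals exact fun x ⟨v, hv, hne⟩ => ⟨v, hW hv, hne⟩

/-- Two families of functionals that vanish equally often at each vector contain equally many
nonzero multiples of a given nonzero functional. -/
theorem ncard_eq_units_smul_eq [Finite F] {A X Y : Type*} [AddCommGroup A] [Module F A]
    (L : X → Module.Dual F A) (L' : Y → Module.Dual F A)
    (hL : ∀ v, {x | L x v ≠ 0}.Finite) (hL' : ∀ v, {y | L' y v ≠ 0}.Finite)
    (h : ∀ v, {x | L x v ≠ 0}.ncard = {y | L' y v ≠ 0}.ncard)
    {f : Module.Dual F A} (hf : f ≠ 0) :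
    {x | ∃ c : Fˣ, L x = c • f}.ncard = {y | ∃ c : Fˣ, L' y = c • f}.ncard := by
  obtain ⟨v₀, hv₀⟩ : ∃ v₀, f v₀ ≠ 0 := by
    by_contra! h0
    exact hf (LinearMap.ext h0)
  have key (g : Module.Dual F A) :
      (∃ c : Fˣ, g = c • f) ↔ g v₀ ≠ 0 ∧ LinearMap.ker f ≤ LinearMap.ker g := by
    constructor
    · rintro ⟨c, rfl⟩
      refine ⟨by simpa [Units.smul_def] using hv₀, fun v hv => ?_⟩
      simp_all [Units.smul_def]
    · rintro ⟨hg, hker⟩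
      refine ⟨Units.mk0 (g v₀ / f v₀) (div_ne_zero hg hv₀), LinearMap.ext fun v => ?_⟩
      have hv : v - (f v / f v₀) • v₀ ∈ LinearMap.ker f := by simp [hv₀]
      have := LinearMap.mem_ker.mp (hker hv)
      rw [map_sub, map_smul, sub_eq_zero] at this
      rw [this]
      simp [Units.smul_def]
      field_simp
  simp only [key]
  exact ncard_le_ker_eq L L' hL hL' h _ v₀

theorem exists_perm_comp_eq {α Q : Type*} [Finite α] (f g : α → Q) (q₀ : Q)
    (h : ∀ q ≠ q₀, {a | f a = q}.ncard = {a | g a = q}.ncard) :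
    ∃ σ : Equiv.Perm α, ∀ a, g (σ a) = f a := by
  classical
  have h₀ : {a | f a = q₀}.ncard = {a | g a = q₀}.ncard := by
    have := Fintype.ofFinite α
    have key (f : α → Q) (U : Finset Q) (hU : ∀ a, f a ∈ U) (hq : q₀ ∈ U) :
        {a | f a = q₀}.ncard + ∑ q ∈ U.erase q₀, {a | f a = q}.ncard = Fintype.card α := by
      rw [Finset.add_sum_erase U (fun q => {a | f a = q}.ncard) hq, ← Finset.card_univ,
        Finset.card_eq_sum_card_fiberwise (f := f) (t := U) (fun a _ => hU a)]
      refine Finset.sum_congr rfl fun q _ => ?_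
      rw [← Set.ncard_coe_finset]
      congr 1
      ext a
      simp
    let U : Finset Q := insert q₀ (Finset.univ.image f ∪ Finset.univ.image g)
    have hf := key f U (by simp [U]) (by simp [U])
    have hg := key g U (by simp [U]) (by simp [U])
    rw [Finset.sum_congr rfl fun q hq => h q (Finset.ne_of_mem_erase hq)] at hf
    omega
  have hall (q : Q) : Nonempty ({a // f a = q} ≃ {a // g a = q}) := by
    refine Nonempty.intro (Classical.choice (Finite.card_eq.mp ?_))
    by_cases hq : q = q₀
    · subst hq; exact h₀
    · exact h q hq
  exact ⟨Equiv.ofFiberEquiv fun q => (hall q).some, fun a => Equiv.ofFiberEquiv_map _ a⟩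

/-- Two families of series-valued linear maps on a shift-invariant space with equal finite total
weight at each vector agree up to a permutation, nonzero scalars and shifts. -/
theorem exists_perm_single_mul_eq [Finite F] {ι A : Type*} [Finite ι] [AddCommGroup A] [Module F A]
    (P Q : ι → A →ₗ[F] LaurentSeries F) (s : ℤ → A → A)
    (hP : ∀ i m v t, (P i (s m v)).coeff (t + m) = (P i v).coeff t)
    (hQ : ∀ i m v t, (Q i (s m v)).coeff (t + m) = (Q i v).coeff t)
    (hPfin : ∀ v, {x : ι × ℤ | (P x.1 v).coeff x.2 ≠ 0}.Finite)
    (hQfin : ∀ v, {x : ι × ℤ | (Q x.1 v).coeff x.2 ≠ 0}.Finite)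
    (hPQ : ∀ v, {x : ι × ℤ | (P x.1 v).coeff x.2 ≠ 0}.ncard =
      {x : ι × ℤ | (Q x.1 v).coeff x.2 ≠ 0}.ncard) :
    ∃ (σ : Equiv.Perm ι) (α : ι → Fˣ) (μ : ι → ℤ), ∀ i v t,
      (Q (σ i) v).coeff (t + μ i) = α i * (P i v).coeff t := by
  let coeffMap (t : ℤ) : LaurentSeries F →ₗ[F] F :=
    { toFun := fun x => x.coeff t, map_add' := by simp, map_smul' := by simp }
  let N : ι ⊕ ι → A →ₗ[F] LaurentSeries F := Sum.elim P Q
  have hN (x) (m v t) : (N x (s m v)).coeff (t + m) = (N x v).coeff t := by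
    cases x
    exacts [hP _ _ _ _, hQ _ _ _ _]
  have hNfin (x) (v) : {t | (N x v).coeff t ≠ 0}.Finite := by
    cases x with
    | inl i => exact (hPfin v).preimage (f := Prod.mk i) (Prod.mk_right_injective i).injOn
    | inr i => exact (hQfin v).preimage (f := Prod.mk i) (Prod.mk_right_injective i).injOn
  let L (x : ι ⊕ ι) (t : ℤ) : Module.Dual F A := coeffMap t ∘ₗ N x
  have hL (x t v) : L x t v = (N x v).coeff t := rfl
  have shift {x y t u} {c : Fˣ} (h : L x t = c • L y u) (m : ℤ) :
      L x (t + m) = c • L y (u + m) := by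
    ext v
    have := LinearMap.congr_fun h (s (-m) v)
    have h1 := hN x (-m) v (t + m)
    have h2 := hN y (-m) v (u + m)
    rw [add_neg_cancel_right] at h1 h2
    simp only [hL, LinearMap.smul_apply, h1, h2] at this ⊢
    exact this
  let S : Setoid (ι ⊕ ι) :=
    { r := fun x y => ∃ (t : ℤ) (c : Fˣ), L x t = c • L y 0
      iseqv :=
        { refl := fun x => ⟨0, 1, by simp⟩
          symm := fun {x y} ⟨t, c, h⟩ => ⟨-t, c⁻¹, by
            have := shift h (-t)
            rw [add_neg_cancel, zero_add] at this
            rw [this, inv_smul_smul]⟩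
          trans := fun {x y z} ⟨t, c, h⟩ ⟨u, d, h'⟩ => ⟨t + u, c * d, by
            have := shift h u
            rw [zero_add, h'] at this
            rw [this, mul_smul]⟩ } }
  have inj {x t u} {f : Module.Dual F A} {c d : Fˣ} (hf : f ≠ 0) (h : L x t = c • f)
      (h' : L x u = d • f) : t = u := by
    by_contra hne
    have h2 : L x t = (c * d⁻¹) • L x u := by rw [h, h', smul_smul, inv_mul_cancel_right]
    obtain ⟨v, hv⟩ : ∃ v, f v ≠ 0 := by
      by_contra! h0
      exact hf (LinearMap.ext h0)
    have hv' : L x t v ≠ 0 := by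
      rw [h]
      simpa [Units.smul_def] using hv
    have hiter (k : ℕ) : L x (t + k * (u - t)) v ≠ 0 := by
      induction k with
      | zero => simpa using hv'
      | succ k ih =>
        have := shift h2 (k * (u - t))
        rw [this] at ih
        intro h0
        refine ih ?_
        rw [show u + k * (u - t) = t + (k + 1 : ℕ) * (u - t) by push_cast; ring]
        rw [LinearMap.smul_apply, h0, smul_zero]
    refine Set.infinite_of_injective_forall_mem (f := fun k : ℕ => t + k * (u - t)) ?_ hiter
      (hNfin x v)
    intro a b hab
    have : (a : ℤ) * (u - t) = b * (u - t) := by simpa using hab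
    exact_mod_cast mul_right_cancel₀ (sub_ne_zero.mpr (Ne.symm hne)) this
  have fiber (e : ι → ι ⊕ ι) (y : ι ⊕ ι) (hy : L y 0 ≠ 0) :
      {i | Quotient.mk S (e i) = Quotient.mk S y}.ncard =
        {x : ι × ℤ | ∃ c : Fˣ, L (e x.1) x.2 = c • L y 0}.ncard := by
    rw [← Set.InjOn.ncard_image (s := {x : ι × ℤ | ∃ c : Fˣ, L (e x.1) x.2 = c • L y 0})
      (f := Prod.fst)]
    · congr 1
      ext i
      simp only [Set.mem_ofPred_eq, Set.mem_image, Prod.exists, exists_and_right, exists_eq_right]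
      exact Quotient.eq
    · rintro ⟨i, t⟩ ⟨c, hc⟩ ⟨j, u⟩ ⟨d, hd⟩ (rfl : i = j)
      exact Prod.ext rfl (inj hy hc hd)
  have classes (y : ι ⊕ ι) (hy : L y 0 ≠ 0) :
      {i | Quotient.mk S (Sum.inl i) = Quotient.mk S y}.ncard =
        {i | Quotient.mk S (Sum.inr i) = Quotient.mk S y}.ncard := by
    rw [fiber _ y hy, fiber _ y hy]
    exact ncard_eq_units_smul_eq (fun x : ι × ℤ => L (Sum.inl x.1) x.2)
      (fun x : ι × ℤ => L (Sum.inr x.1) x.2) hPfin hQfin hPQ hy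
  obtain ⟨σ, hσ⟩ : ∃ σ : Equiv.Perm ι, ∀ i,
      Quotient.mk S (Sum.inr (σ i)) = Quotient.mk S (Sum.inl i) := by
    by_cases hz : ∃ z, L z 0 = 0
    · obtain ⟨z, hz⟩ := hz
      refine exists_perm_comp_eq (fun i => Quotient.mk S (Sum.inl i))
          (fun i => Quotient.mk S (Sum.inr i)) (Quotient.mk S z) fun q hq => ?_
      induction q using Quotient.inductionOn with
      | h y =>
        refine classes y fun hy => hq (Quotient.sound ⟨0, 1, ?_⟩)
        rw [hy, hz, smul_zero]
    · push Not at hz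
      rcases isEmpty_or_nonempty ι with hι | ⟨⟨i₀⟩⟩
      · exact ⟨1, fun i => isEmptyElim i⟩
      · refine exists_perm_comp_eq (fun i => Quotient.mk S (Sum.inl i))
          (fun i => Quotient.mk S (Sum.inr i)) (Quotient.mk S (Sum.inl i₀)) fun q _ => ?_
        induction q using Quotient.inductionOn with
        | h y => exact classes y (hz y)
  choose μ α h using fun i => Quotient.exact (hσ i)
  refine ⟨σ, α, μ, fun i v t => ?_⟩
  have := LinearMap.congr_fun (shift (h i) t) v
  rw [add_comm t, ← zero_add t]
  simpa [hL, N, Units.smul_def] using this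

theorem wtL_eq_encard {n : ℕ} (v : Fin n → LaurentSeries F) :
    wtL v = {x : Fin n × ℤ | (v x.1).coeff x.2 ≠ 0}.encard := by
  have : {x : Fin n × ℤ | (v x.1).coeff x.2 ≠ 0} = ⋃ i, Prod.mk i '' (v i).support := by
    ext ⟨i, t⟩
    simp
  rw [this, Set.encard_iUnion_of_finite, finsum_eq_sum_of_fintype]
  · exact Finset.sum_congr rfl fun i _ =>
      ((Prod.mk_right_injective i).injOn.encard_image).symm
  · intro i j hij
    rw [Function.onFun, Set.disjoint_left]
    rintro _ ⟨t, -, rfl⟩ ⟨u, -, h⟩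
    exact hij (congrArg Prod.fst h).symm

theorem wtL_ne_top_iff {n : ℕ} (v : Fin n → LaurentSeries F) :
    wtL v ≠ ⊤ ↔ {x : Fin n × ℤ | (v x.1).coeff x.2 ≠ 0}.Finite := by
  rw [wtL_eq_encard, Set.encard_ne_top_iff]

theorem delL_nonneg_iff {n : ℕ} {v : Fin n → LaurentSeries F} (hv : v ≠ 0) :
    0 ≤ delL v ↔ ∀ t < 0, ∀ i, (v i).coeff t = 0 := by
  have hne : {t : ℤ | ∃ i, (v i).coeff t ≠ 0}.Nonempty := by
    by_contra! h
    refine hv (funext fun i => HahnSeries.ext (funext fun t => ?_))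
    by_contra ht
    have : t ∈ {t : ℤ | ∃ i, (v i).coeff t ≠ 0} := ⟨i, ht⟩
    simp [h] at this
  have hbdd : BddBelow {t : ℤ | ∃ i, (v i).coeff t ≠ 0} := by
    have : {t : ℤ | ∃ i, (v i).coeff t ≠ 0} = ⋃ i, (v i).support := by
      ext t
      simp
    rw [this, ← Set.biUnion_univ, Set.finite_univ.bddBelow_biUnion]
    exact fun i _ => ⟨(v i).order, fun t ht => HahnSeries.order_le_of_coeff_ne_zero ht⟩
  rw [delL, le_csInf_iff hbdd hne]
  constructor
  · intro h t ht i
    by_contra h0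
    exact absurd (h t ⟨i, h0⟩) (by omega)
  · rintro h t ⟨i, hi⟩
    by_contra ht
    exact hi (h t (by omega) i)

/-- The polynomial vectors are the vectors of finite weight without terms of negative degree. -/
theorem exists_algebraMap_eq_iff {n : ℕ} (v : Fin n → LaurentSeries F) :
    (∃ u : Fin n → F[X], (fun i => algebraMap F[X] (LaurentSeries F) (u i)) = v) ↔
      wtL v ≠ ⊤ ∧ ∀ t < 0, ∀ i, (v i).coeff t = 0 := by
  have hpos (p : F[X]) (t : ℕ) : (algebraMap F[X] (LaurentSeries F) p).coeff t = p.coeff t := by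
    simp [Polynomial.algebraMap_hahnSeries_apply]
  have hneg (p : F[X]) (t : ℤ) (ht : t < 0) :
      (algebraMap F[X] (LaurentSeries F) p).coeff t = 0 := by
    rw [Polynomial.algebraMap_hahnSeries_apply, PowerSeries.coeff_coe, if_pos ht]
  rw [wtL_ne_top_iff]
  constructor
  · rintro ⟨u, rfl⟩
    refine ⟨?_, fun t ht i => hneg _ t ht⟩
    refine Set.Finite.subset
      (Set.finite_iUnion fun i => (u i).support.finite_toSet.image fun m : ℕ => (i, (m : ℤ))) ?_
    rintro ⟨i, t⟩ h
    rw [Set.mem_iUnion]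
    refine ⟨i, ?_⟩
    simp only [Set.mem_ofPred_eq] at h
    have ht : 0 ≤ t := by
      by_contra! ht
      exact h (hneg _ t ht)
    lift t to ℕ using ht
    rw [hpos] at h
    exact ⟨t, by simpa using h, rfl⟩
  · rintro ⟨hfin, h0⟩
    have hfin' (i : Fin n) : {t : ℕ | (v i).coeff t ≠ 0}.Finite :=
      hfin.preimage (f := fun t : ℕ => (i, (t : ℤ))) fun a _ b _ hab => by simpa using hab
    refine ⟨fun i => ∑ t ∈ (hfin' i).toFinset, Polynomial.monomial t ((v i).coeff t), ?_⟩
    funext i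
    ext t
    rcases lt_or_ge t 0 with ht | ht
    · rw [hneg _ t ht, h0 t ht i]
    · lift t to ℕ using ht
      rw [hpos]
      simp +contextual [Polynomial.finsetSum_coeff, Polynomial.coeff_monomial]

theorem coeff_add_single_smul {n : ℕ} (v : Fin n → LaurentSeries F) (m : ℤ) (i : Fin n) (t : ℤ) :
    (((HahnSeries.single m (1 : F) : LaurentSeries F) • v) i).coeff (t + m) = (v i).coeff t := by
  rw [Pi.smul_apply, smul_eq_mul, HahnSeries.coeff_single_mul_add, one_mul]

theorem C_smul_eq {n : ℕ} (c : F) (v : Fin n → LaurentSeries F) :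
    c • v = (HahnSeries.C c : LaurentSeries F) • v := by
  funext i
  simp only [Pi.smul_apply, smul_eq_mul, HahnSeries.C_mul_eq_smul]

/-- A weight-preserving map between Laurent series codes acts on the codewords of finite weight by
a permutation of the coordinates, nonzero scalars and shifts. -/
theorem exists_perm_coeff_eq_of_wtL_eq [Finite F] {n : ℕ}
    (C D : Submodule (LaurentSeries F) (Fin n → LaurentSeries F))
    (φ : C →ₗ[LaurentSeries F] D)
    (hwt : ∀ v : C, wtL ((φ v : Fin n → LaurentSeries F)) = wtL (v : Fin n → LaurentSeries F)) :
    ∃ (σ : Equiv.Perm (Fin n)) (α : Fin n → Fˣ) (μ : Fin n → ℤ), ∀ v : C,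
      wtL (v : Fin n → LaurentSeries F) ≠ ⊤ → ∀ i t,
      ((φ v : Fin n → LaurentSeries F) (σ i)).coeff (t + μ i) =
        α i * ((v : Fin n → LaurentSeries F) i).coeff t := by
  let A : Submodule F (Fin n → LaurentSeries F) :=
    { carrier := {v | v ∈ C ∧ wtL v ≠ ⊤}
      zero_mem' := by simp [wtL_ne_top_iff, C.zero_mem]
      add_mem' := by
        rintro v w ⟨hvC, hv⟩ ⟨hwC, hw⟩
        rw [wtL_ne_top_iff] at hv hw
        refine ⟨C.add_mem hvC hwC, (wtL_ne_top_iff _).mpr ((hv.union hw).subset fun x hx => ?_)⟩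
        by_contra h
        simp_all
      smul_mem' := by
        rintro c v ⟨hvC, hv⟩
        rw [wtL_ne_top_iff] at hv
        refine ⟨?_, (wtL_ne_top_iff _).mpr (hv.subset fun x hx => ?_)⟩
        · rw [C_smul_eq]
          exact C.smul_mem _ hvC
        · by_contra h
          simp_all }
  have shift_mem (m : ℤ) (v : A) :
      (HahnSeries.single m (1 : F) : LaurentSeries F) • (v : Fin n → LaurentSeries F) ∈ A := by
    obtain ⟨v, hvC, hv⟩ := v
    refine ⟨C.smul_mem _ hvC, ?_⟩
    rw [wtL_ne_top_iff] at hv ⊢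
    refine (hv.image fun x => (x.1, x.2 + m)).subset ?_
    rintro ⟨i, t⟩ hx
    refine ⟨(i, t - m), ?_, by simp⟩
    have := coeff_add_single_smul v m i (t - m)
    rw [sub_add_cancel] at this
    change _ ≠ _
    rw [← this]
    exact hx
  let P (i : Fin n) : A →ₗ[F] LaurentSeries F := LinearMap.proj i ∘ₗ A.subtype
  let Q (i : Fin n) : A →ₗ[F] LaurentSeries F :=
    { toFun := fun v => (φ ⟨v, v.2.1⟩ : Fin n → LaurentSeries F) i
      map_add' := fun v w => by
        have : (⟨_, (v + w).2.1⟩ : C) = ⟨v, v.2.1⟩ + ⟨w, w.2.1⟩ := rfl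
        rw [this, map_add]
        rfl
      map_smul' := fun c v => by
        have : (⟨_, (c • v).2.1⟩ : C) = (HahnSeries.C c : LaurentSeries F) • ⟨v, v.2.1⟩ :=
          Subtype.ext (C_smul_eq c _)
        rw [this, map_smul, Submodule.coe_smul, ← C_smul_eq]
        rfl }
  have hfin (v : A) : wtL (φ ⟨v, v.2.1⟩ : Fin n → LaurentSeries F) ≠ ⊤ := by
    rw [hwt]
    exact v.2.2
  obtain ⟨σ, α, μ, h⟩ := exists_perm_single_mul_eq P Q
    (fun m v => ⟨_, shift_mem m v⟩)
    (fun i m v t => coeff_add_single_smul _ m i t)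
    (fun i m v t => by
      change ((φ ((HahnSeries.single m (1 : F) : LaurentSeries F) • ⟨v, v.2.1⟩) :
        Fin n → LaurentSeries F) i).coeff _ = _
      rw [map_smul]
      exact coeff_add_single_smul _ m i t)
    (fun v => (wtL_ne_top_iff _).mp v.2.2)
    (fun v => (wtL_ne_top_iff _).mp (hfin v))
    (fun v => by
      have := hwt ⟨v, v.2.1⟩
      exact congrArg ENat.toNat
        ((wtL_eq_encard _).symm.trans (this.symm.trans (wtL_eq_encard _))))
  exact ⟨σ, α, μ, fun v hv i t => h i ⟨v, v.2, hv⟩ t⟩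

/-- A delay-preserving `R`-isometry between Laurent series codes yields `z`-monomially
equivalent polynomial codes. -/
theorem stmt17 {F : Type*} [Field F] [Fintype F] {k n : ℕ}
    (C Cbar : Submodule (LaurentSeries F) (Fin n → LaurentSeries F))
    (hC : IsLSCode k C) (hCbar : IsLSCode k Cbar)
    (φ : C ≃ₗ[LaurentSeries F] Cbar)
    (hwt : ∀ v : C, wtL ((φ v : Fin n → LaurentSeries F)) = wtL (v : Fin n → LaurentSeries F))
    (hdel : ∀ v : C, (v : Fin n → LaurentSeries F) ≠ 0 →
      delL ((φ v : Fin n → LaurentSeries F)) = delL (v : Fin n → LaurentSeries F)) :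
    ∃ M : Matrix (Fin n) (Fin n) (RatFunc F), IsZMonomial M ∧
      ((fun v : Fin n → Polynomial F =>
          (fun i => algebraMap (Polynomial F) (RatFunc F) (v i)) ᵥ* M) ''
        {v : Fin n → Polynomial F |
          (fun i => algebraMap (Polynomial F) (LaurentSeries F) (v i)) ∈ C})
      = ((fun v : Fin n → Polynomial F =>
          fun i => algebraMap (Polynomial F) (RatFunc F) (v i)) ''
        {v : Fin n → Polynomial F |
          (fun i => algebraMap (Polynomial F) (LaurentSeries F) (v i)) ∈ Cbar}) := by
  obtain ⟨σ, α, μ, h⟩ := exists_perm_coeff_eq_of_wtL_eq C Cbar φ.toLinearMap hwt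
  let _ : Algebra (RatFunc F) (LaurentSeries F) := RatFunc.liftAlgebra F (LaurentSeries F)
  let M : Matrix (Fin n) (Fin n) (RatFunc F) := fun i j =>
    if σ i = j then algebraMap F (RatFunc F) (α (σ.symm j)) * RatFunc.X ^ μ (σ.symm j) else 0
  have hinj : Function.Injective (algebraMap (RatFunc F) (LaurentSeries F)) :=
    RingHom.injective _
  have hent (i : Fin n) :
      algebraMap (RatFunc F) (LaurentSeries F)
        (algebraMap F (RatFunc F) (α i) * RatFunc.X ^ μ i) =
        HahnSeries.single (μ i) (α i : F) := by
    have hc : algebraMap (RatFunc F) (LaurentSeries F) (algebraMap F (RatFunc F) (α i)) =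
        HahnSeries.C (α i : F) := by
      rw [RatFunc.algebraMap_eq_C, ← RatFunc.algebraMap_C, ← IsScalarTower.algebraMap_apply,
        Polynomial.algebraMap_hahnSeries_apply, Polynomial.coe_C, HahnSeries.ofPowerSeries_C]
    rw [map_mul, map_zpow₀, RatFunc.coe_X, ← RatFunc.single_zpow, hc, HahnSeries.C_apply,
      HahnSeries.single_mul_single, zero_add, mul_one]
  have hmul (u w : Fin n → F[X])
      (hu : (fun i => algebraMap F[X] (LaurentSeries F) (u i)) ∈ C)
      (hw : (fun i => algebraMap F[X] (LaurentSeries F) (w i)) = φ ⟨_, hu⟩) :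
      (fun i => algebraMap F[X] (RatFunc F) (u i)) ᵥ* M =
        fun i => algebraMap F[X] (RatFunc F) (w i) := by
    funext j
    obtain ⟨i, rfl⟩ := σ.surjective j
    have hsum : ((fun i => algebraMap F[X] (RatFunc F) (u i)) ᵥ* M) (σ i) =
        algebraMap F[X] (RatFunc F) (u i) *
          (algebraMap F (RatFunc F) (α i) * RatFunc.X ^ μ i) := by
      rw [Matrix.vecMul, dotProduct, Finset.sum_eq_single i]
      · simp [M]
      · intro b _ hb
        simp [M, hb]
      · simp
    rw [hsum]
    apply hinj
    rw [map_mul, hent, ← IsScalarTower.algebraMap_apply, ← IsScalarTower.algebraMap_apply]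
    rw [congrFun hw (σ i), mul_comm]
    ext t
    have := h ⟨_, hu⟩ ((exists_algebraMap_eq_iff _).mp ⟨u, rfl⟩).1 i (t - μ i)
    rw [sub_add_cancel] at this
    refine Eq.trans ?_ this.symm
    exact HahnSeries.coeff_single_mul
  have hpol (v : C) :
      (∃ u : Fin n → F[X], (fun i => algebraMap F[X] (LaurentSeries F) (u i)) = v) ↔
      ∃ u : Fin n → F[X], (fun i => algebraMap F[X] (LaurentSeries F) (u i)) = φ v := by
    by_cases hv : v = 0
    · simp [hv]
    · have hv₁ : (v : Fin n → LaurentSeries F) ≠ 0 := by simpa using hv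
      have hv₂ : (φ v : Fin n → LaurentSeries F) ≠ 0 := by simpa using hv
      rw [exists_algebraMap_eq_iff, exists_algebraMap_eq_iff, ← delL_nonneg_iff hv₁,
        ← delL_nonneg_iff hv₂, hwt, hdel v hv₁]
  refine ⟨M, ⟨σ, fun j => α (σ.symm j), fun j => μ (σ.symm j), fun i j => rfl⟩, ?_⟩
  apply Set.Subset.antisymm
  · rintro _ ⟨u, hu, rfl⟩
    obtain ⟨w, hw⟩ := (hpol ⟨_, hu⟩).mp ⟨u, rfl⟩
    refine ⟨w, ?_, (hmul u w hu hw).symm⟩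
    change _ ∈ Cbar
    rw [hw]
    exact Subtype.coe_prop _
  · rintro _ ⟨w, hw, rfl⟩
    obtain ⟨u, hu⟩ := (hpol (φ.symm ⟨_, hw⟩)).mpr ⟨w, by simp⟩
    have hmem : (fun i => algebraMap F[X] (LaurentSeries F) (u i)) ∈ C := by
      rw [hu]
      exact Subtype.coe_prop _
    refine ⟨u, hmem, hmul u w hmem ?_⟩
    have : (⟨_, hmem⟩ : C) = φ.symm ⟨_, hw⟩ := Subtype.ext hu
    rw [this]
    simp
end

section
/- Let R = F((z)) and let C, C̄ ⊆ R^n be k-dimensional R-codes. If C and C̄ are R-isometric (there exists an R-isometry φ : C → C̄), then their dual codes C^⊥ = {w ∈ R^n : v·wᵀ = 0 for all v ∈ C} and C̄^⊥ = {w ∈ R^n : v·wᵀ = 0 for all v ∈ C̄} are R-isometric. -/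
open Matrix Polynomial

variable {F : Type*} [Field F]

/-- The dual of a code over the Laurent series field. -/
def dualLS {n : ℕ} (C : Submodule (LaurentSeries F) (Fin n → LaurentSeries F)) :
    Submodule (LaurentSeries F) (Fin n → LaurentSeries F) where
  carrier := {w | ∀ v ∈ C, ∑ i, v i * w i = 0}
  add_mem' := by
    intro a b ha hb v hv
    have : ∑ i, v i * (a i + b i) = (∑ i, v i * a i) + ∑ i, v i * b i := by
      rw [← Finset.sum_add_distrib]
      exact Finset.sum_congr rfl fun i _ => by ring
    simp only [Pi.add_apply, this, ha v hv, hb v hv, add_zero]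
  zero_mem' := by intro v hv; simp
  smul_mem' := by
    intro c w hw v hv
    have h1 : ∑ i, v i * (c * w i) = c * ∑ i, v i * w i := by
      rw [Finset.mul_sum]
      exact Finset.sum_congr rfl fun i _ => by ring
    simp only [Pi.smul_apply, smul_eq_mul, h1, hw v hv, mul_zero]

theorem LinearMap.card_ne_zero_eq [Finite F] {E : Type*} [AddCommGroup E] [Module F E]
    (φ g : E →ₗ[F] F) (hφ : φ ≠ 0) (h : ∃ u, φ u = 0 ∧ g u ≠ 0) :
    Nat.card {u // g u ≠ 0} = Nat.card F * Nat.card {u // φ u = 0 ∧ g u ≠ 0} := by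
  obtain ⟨k, hk, hgk⟩ := h
  obtain ⟨u₀, hu₀⟩ : ∃ u, φ u ≠ 0 := by
    by_contra! h
    exact hφ (LinearMap.ext h)
  obtain ⟨u₁, h1, h2⟩ : ∃ u, φ u = 1 ∧ g u = 0 := by
    refine ⟨(φ u₀)⁻¹ • (u₀ - (g u₀ / g k) • k), ?_, ?_⟩
    · simp [hk, hu₀]
    · simp [hgk]
  rw [← Nat.card_prod]
  exact Nat.card_congr
    { toFun := fun u => (φ u, ⟨u - φ u • u₁, by simp [h1], by simpa [h2] using u.2⟩)
      invFun := fun p => ⟨p.2 + p.1 • u₁, by simpa [h2] using p.2.2.2⟩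
      left_inv := fun u => by simp
      right_inv := fun p => by ext <;> simp [h1, p.2.2.1] }

theorem LinearMap.mul_card_le_card_ne_zero [Finite F] {E : Type*} [AddCommGroup E] [Module F E]
    (φ g : E →ₗ[F] F) (hφ : φ ≠ 0) :
    Nat.card F * Nat.card {u // φ u = 0 ∧ g u ≠ 0} ≤ Nat.card {u // g u ≠ 0} := by
  by_cases h : ∃ u, φ u = 0 ∧ g u ≠ 0
  · exact (card_ne_zero_eq φ g hφ h).ge
  · have : IsEmpty {u // φ u = 0 ∧ g u ≠ 0} := ⟨fun u => h ⟨u.1, u.2⟩⟩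
    simp

open Classical in
theorem Finset.sum_natCard_and_eq {E ι : Type*} [Finite E] [Fintype E] (A : Finset ι)
    (p : E → Prop) (r : ι → E → Prop) :
    ∑ i ∈ A, Nat.card {u // p u ∧ r i u} =
      ∑ u with p u, (A.filter fun i => r i u).card := by
  have := Finset.sum_card_bipartiteAbove_eq_sum_card_bipartiteBelow (s := A)
    (t := Finset.univ.filter p) r
  simp only [Finset.bipartiteAbove, Finset.bipartiteBelow, Finset.filter_filter] at this
  rw [← this]
  exact Finset.sum_congr rfl fun i _ => Nat.subtype_card _ (by simp)

open Classical in
theorem exists_ne_zero_forall_ker_of_finite [Finite F] {E I J : Type*} [AddCommGroup E] [Module F E]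
    [Finite E] (f : I → E →ₗ[F] F) (g : J → E →ₗ[F] F) (S : Finset I) (T : Finset J)
    (h : ∀ u, (S.filter fun i => f i u ≠ 0).card = (T.filter fun j => g j u ≠ 0).card)
    {i₀ : I} (hi₀ : i₀ ∈ S) (h0 : f i₀ ≠ 0) :
    ∃ j ∈ T, g j ≠ 0 ∧ ∀ u, f i₀ u = 0 → g j u = 0 := by
  have := Fintype.ofFinite E
  by_contra! hcon
  have total : ∀ p : E → Prop, ∑ i ∈ S, Nat.card {u // p u ∧ f i u ≠ 0} =
      ∑ j ∈ T, Nat.card {u // p u ∧ g j u ≠ 0} := fun p => by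
    rw [Finset.sum_natCard_and_eq, Finset.sum_natCard_and_eq]
    exact Finset.sum_congr rfl fun u _ => by convert h u
  have hT : ∑ j ∈ T, Nat.card {u // g j u ≠ 0} =
      Nat.card F * ∑ j ∈ T, Nat.card {u // f i₀ u = 0 ∧ g j u ≠ 0} := by
    rw [Finset.mul_sum]
    refine Finset.sum_congr rfl fun j hj => ?_
    by_cases hg : g j = 0
    · simp [hg]
    · exact LinearMap.card_ne_zero_eq _ _ h0 (hcon j hj hg)
  have hS : Nat.card F * ∑ i ∈ S, Nat.card {u // f i₀ u = 0 ∧ f i u ≠ 0} <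
      ∑ i ∈ S, Nat.card {u // f i u ≠ 0} := by
    rw [Finset.mul_sum]
    refine Finset.sum_lt_sum (fun i _ => LinearMap.mul_card_le_card_ne_zero _ _ h0)
      ⟨i₀, hi₀, ?_⟩
    have h1 : IsEmpty {u // f i₀ u = 0 ∧ f i₀ u ≠ 0} := ⟨fun u => u.2.2 u.2.1⟩
    have h2 : Nonempty {u // f i₀ u ≠ 0} := by
      by_contra hn
      exact h0 (LinearMap.ext fun u => by_contra fun hu => hn ⟨u, hu⟩)
    rw [Nat.card_of_isEmpty (α := {u // f i₀ u = 0 ∧ f i₀ u ≠ 0}), mul_zero]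
    exact Nat.card_pos
  have hall := total fun _ => True
  simp only [true_and] at hall
  rw [total, ← hT, hall] at hS
  exact lt_irrefl _ hS

/-- Two locally finite families of functionals that are nonzero equally often at every point have
the same nonzero members up to scalars. -/
theorem exists_eq_smul_of_encard_ne_zero_eq [Finite F] {E I J : Type*} [AddCommGroup E]
    [Module F E] (f : I → E →ₗ[F] F) (g : J → E →ₗ[F] F)
    (hf : ∀ u, {i | f i u ≠ 0}.Finite)
    (h : ∀ u, {i | f i u ≠ 0}.encard = {j | g j u ≠ 0}.encard)
    {i₀ : I} (h0 : f i₀ ≠ 0) : ∃ j, ∃ c : F, c ≠ 0 ∧ g j = c • f i₀ := by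
  classical
  have hg : ∀ u, {j | g j u ≠ 0}.Finite := fun u => by
    rw [← Set.encard_lt_top_iff, ← h u, Set.encard_lt_top_iff]
    exact hf u
  obtain ⟨u₀, hu₀⟩ : ∃ u, f i₀ u ≠ 0 := by
    by_contra! h
    exact h0 (LinearMap.ext h)
  by_contra! hcon
  have hw : ∀ j, ∃ u, g j u₀ ≠ 0 → f i₀ u = 0 ∧ g j u ≠ 0 := by
    intro j
    by_cases hj : g j u₀ = 0
    · exact ⟨0, fun hj' => absurd hj hj'⟩
    by_contra! hker
    refine hcon j (g j u₀ / f i₀ u₀) (div_ne_zero hj hu₀) (LinearMap.ext fun u => ?_)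
    have := (hker (u - (f i₀ u / f i₀ u₀) • u₀)).2 (by simp [hu₀])
    simp only [map_sub, map_smul, smul_eq_mul, LinearMap.smul_apply] at this ⊢
    rw [sub_eq_zero.1 this]
    ring
  choose w hw using hw
  let V : Submodule F E := Submodule.span F (insert u₀ (w '' {j | g j u₀ ≠ 0}))
  have hu₀V : u₀ ∈ V := Submodule.subset_span (Set.mem_insert _ _)
  have : FiniteDimensional F V :=
    FiniteDimensional.span_of_finite F (((hg u₀).image w).insert u₀)
  have : Finite V := Module.finite_of_finite F
  let S := (Set.finite_iUnion fun u : V => hf u).toFinset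
  let T := (Set.finite_iUnion fun u : V => hg u).toFinset
  have hST : ∀ u : V, (S.filter fun i => f i u ≠ 0).card = (T.filter fun j => g j u ≠ 0).card := by
    intro u
    have h1 : ((S.filter fun i => f i u ≠ 0 : Finset I) : Set I) = {i | f i u ≠ 0} := by
      ext i
      simpa [S] using fun hi => ⟨u, u.2, hi⟩
    have h2 : ((T.filter fun j => g j u ≠ 0 : Finset J) : Set J) = {j | g j u ≠ 0} := by
      ext j
      simpa [T] using fun hj => ⟨u, u.2, hj⟩
    have := h u
    rw [← h1, ← h2, Set.encard_coe_eq_coe_finsetCard, Set.encard_coe_eq_coe_finsetCard] at this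
    exact_mod_cast this
  obtain ⟨j, -, hj, hker⟩ := exists_ne_zero_forall_ker_of_finite
    (fun i => f i ∘ₗ V.subtype) (fun j => g j ∘ₗ V.subtype) S T hST (i₀ := i₀)
    (by simpa [S] using ⟨u₀, hu₀V, hu₀⟩)
    (fun h => hu₀ (by simpa using LinearMap.congr_fun h ⟨u₀, hu₀V⟩))
  simp only [LinearMap.comp_apply, Submodule.subtype_apply, Subtype.forall] at hker
  by_cases hju : g j u₀ = 0
  · refine hj (LinearMap.ext fun u => ?_)
    have := hker (u - (f i₀ u / f i₀ u₀) • u₀) (V.sub_mem u.2 (V.smul_mem _ hu₀V))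
      (by simp [hu₀])
    simpa [hju] using this
  · have hwj := hw j hju
    exact hwj.2 (hker _ (Submodule.subset_span (Or.inr ⟨j, hju, rfl⟩)) hwj.1)

theorem LaurentSeries.support_single_smul (t : ℤ) {c : F} (hc : c ≠ 0) (x : LaurentSeries F) :
    (HahnSeries.single t c • x).support = (fun s => s - t) ⁻¹' x.support := by
  ext s
  simp [HahnSeries.coeff_single_mul, hc]

theorem LaurentSeries.encard_support_single_smul (t : ℤ) {c : F} (hc : c ≠ 0)
    (x : LaurentSeries F) : (HahnSeries.single t c • x).support.encard = x.support.encard := by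
  rw [support_single_smul t hc]
  exact Set.encard_preimage_of_bijective (Equiv.subRight t).bijective _

theorem LaurentSeries.finite_support_single_smul (t : ℤ) (c : F) {x : LaurentSeries F}
    (hx : x.support.Finite) : (HahnSeries.single t c • x).support.Finite := by
  by_cases hc : c = 0
  · simp [hc]
  · rw [← Set.encard_lt_top_iff, encard_support_single_smul t hc]
    exact hx.encard_lt_top

theorem Finset.encard_setOf_snd_mem_eq_sum {ι α : Type*} (A : Finset ι) (s : ι → Set α) :
    {p : A × α | p.2 ∈ s p.1}.encard = ∑ i ∈ A, (s i).encard := by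
  have : {p : A × α | p.2 ∈ s p.1} = ⋃ i : A, Prod.mk i '' s i := by
    ext ⟨i, x⟩
    simp
  rw [this, Set.encard_iUnion_of_finite, finsum_eq_sum_of_fintype, ← Finset.sum_coe_sort A fun i => (s i).encard]
  · exact Finset.sum_congr rfl fun i _ => (Prod.mk_right_injective i).encard_image _
  · intro i j hij
    rw [Function.onFun, Set.disjoint_left]
    rintro _ ⟨x, -, rfl⟩ ⟨y, -, h⟩
    exact hij (congrArg Prod.fst h).symm

section

variable {M ι : Type*} [AddCommGroup M] [Module (LaurentSeries F) M]

/-- Over a spanning, shift-invariant group of vectors of finite weight, two tuples of linear forms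
with equal weights have the same nonzero members up to monomial factors. -/
theorem exists_eq_single_smul_of_sum_encard_support_eq [Finite F]
    (a b : ι → M →ₗ[LaurentSeries F] LaurentSeries F) (E : AddSubgroup M)
    (hE : ∀ t c, ∀ v ∈ E, (HahnSeries.single t c : LaurentSeries F) • v ∈ E)
    (hspan : Submodule.span (LaurentSeries F) (E : Set M) = ⊤) (A B : Finset ι)
    (hfin : ∀ i ∈ A, ∀ v ∈ E, (a i v).support.Finite)
    (hw : ∀ v ∈ E, ∑ i ∈ A, (a i v).support.encard = ∑ j ∈ B, (b j v).support.encard)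
    {i₀ : ι} (hi₀ : i₀ ∈ A) (h0 : a i₀ ≠ 0) :
    ∃ j ∈ B, ∃ (t : ℤ) (c : F), c ≠ 0 ∧ b j = (HahnSeries.single t c : LaurentSeries F) • a i₀ := by
  let _ : Module F M := Module.compHom M (HahnSeries.C : F →+* LaurentSeries F)
  have smul_def : ∀ (c : F) (v : M), c • v = (HahnSeries.single 0 c : LaurentSeries F) • v :=
    fun _ _ => rfl
  let E' : Submodule F M := { E with smul_mem' := fun c v hv => hE 0 c v hv }
  let f : (M →ₗ[LaurentSeries F] LaurentSeries F) → ℤ → E' →ₗ[F] F := fun x t =>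
    { toFun := fun v => (x v).coeff t
      map_add' := by simp
      map_smul' := by simp [smul_def] }
  have hsupp : ∀ (A : Finset ι) (a : ι → M →ₗ[LaurentSeries F] LaurentSeries F) (v : E'),
      {p : A × ℤ | f (a p.1) p.2 v ≠ 0}.encard = ∑ i ∈ A, (a i v).support.encard :=
    fun A a v => Finset.encard_setOf_snd_mem_eq_sum A fun i => (a i v).support
  obtain ⟨v₀, hv₀, t₀, ht₀⟩ : ∃ v ∈ E, ∃ t, (a i₀ v).coeff t ≠ 0 := by
    by_contra! h
    exact h0 (LinearMap.ext_on hspan fun v hv => HahnSeries.ext (funext (h v hv)))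
  obtain ⟨⟨j, t⟩, c, hc, hj⟩ := exists_eq_smul_of_encard_ne_zero_eq
    (fun p : A × ℤ => f (a p.1) p.2) (fun p : B × ℤ => f (b p.1) p.2)
    (fun v => by
      rw [← Set.encard_lt_top_iff, hsupp]
      exact WithTop.sum_lt_top.2 fun i hi => (hfin i hi v v.2).encard_lt_top)
    (fun v => by rw [hsupp, hsupp, hw v v.2])
    (i₀ := (⟨i₀, hi₀⟩, t₀)) (fun h => ht₀ (LinearMap.congr_fun h ⟨v₀, hv₀⟩))
  refine ⟨j, j.2, t - t₀, c, hc, LinearMap.ext_on hspan fun v hv => HahnSeries.ext ?_⟩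
  funext s
  have := LinearMap.congr_fun hj ⟨_, hE (t - s) 1 v hv⟩
  simp only [f, LinearMap.coe_mk, AddHom.coe_mk, LinearMap.smul_apply, map_smul, smul_eq_mul,
    HahnSeries.coeff_single_mul, one_mul] at this ⊢
  convert this using 3 <;> ring

theorem exists_injOn_eq_single_smul_of_sum_encard_support_eq [Finite F]
    (a b : ι → M →ₗ[LaurentSeries F] LaurentSeries F) (E : AddSubgroup M)
    (hE : ∀ t c, ∀ v ∈ E, (HahnSeries.single t c : LaurentSeries F) • v ∈ E)
    (hspan : Submodule.span (LaurentSeries F) (E : Set M) = ⊤) (A B : Finset ι)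
    (hcard : A.card = B.card)
    (hfin : ∀ i ∈ A, ∀ v ∈ E, (a i v).support.Finite)
    (hw : ∀ v ∈ E, ∑ i ∈ A, (a i v).support.encard = ∑ j ∈ B, (b j v).support.encard) :
    ∃ σ : ι → ι, Set.MapsTo σ A B ∧ Set.InjOn σ A ∧ ∀ i ∈ A, ∃ (t : ℤ) (c : F), c ≠ 0 ∧
      b (σ i) = (HahnSeries.single t c : LaurentSeries F) • a i := by
  classical
  induction hm : A.card generalizing A B with
  | zero =>
    rw [Finset.card_eq_zero] at hm
    exact ⟨id, by simp [hm, Set.MapsTo]⟩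
  | succ m ih =>
    obtain ⟨i₀, hi₀, j₀, hj₀, t, c, hc, hb⟩ : ∃ i ∈ A, ∃ j ∈ B, ∃ (t : ℤ) (c : F), c ≠ 0 ∧
        b j = (HahnSeries.single t c : LaurentSeries F) • a i := by
      by_cases h : ∃ i ∈ A, a i ≠ 0
      · obtain ⟨i, hi, h0⟩ := h
        exact ⟨i, hi, exists_eq_single_smul_of_sum_encard_support_eq a b E hE hspan A B hfin hw
          hi h0⟩
      · push Not at h
        obtain ⟨i, hi⟩ : A.Nonempty := Finset.card_pos.1 (by lia)
        obtain ⟨j, hj⟩ : B.Nonempty := Finset.card_pos.1 (by lia)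
        refine ⟨i, hi, j, hj, 0, 1, one_ne_zero, ?_⟩
        rw [h i hi, smul_zero]
        refine LinearMap.ext_on hspan fun v hv => ?_
        have := hw v hv
        rw [Finset.sum_eq_zero fun i hi => by simp [h i hi], eq_comm,
          Finset.sum_eq_zero_iff] at this
        simpa using this j hj
    obtain ⟨σ, hmaps, hinj, hσ⟩ := ih (A.erase i₀) (B.erase j₀)
      (by rw [Finset.card_erase_of_mem hi₀, Finset.card_erase_of_mem hj₀, hcard])
      (fun i hi => hfin i (Finset.mem_of_mem_erase hi))
      (fun v hv => by
        have := hw v hv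
        rw [← Finset.add_sum_erase A _ hi₀, ← Finset.add_sum_erase B _ hj₀, hb,
          LinearMap.smul_apply, LaurentSeries.encard_support_single_smul t hc] at this
        exact (WithTop.add_left_inj (hfin i₀ hi₀ v hv).encard_lt_top.ne).1 this)
      (by rw [Finset.card_erase_of_mem hi₀, hm, Nat.add_sub_cancel])
    have hne : ∀ i ∈ A, i ≠ i₀ → σ i ≠ j₀ ∧ σ i ∈ B := fun i hi hii => by
      simpa [and_comm] using hmaps (show i ∈ ((A.erase i₀ : Finset ι) : Set ι) by simp [hi, hii])
    refine ⟨Function.update σ i₀ j₀, fun i hi => ?_, fun i hi i' hi' h => ?_, fun i hi => ?_⟩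
    · by_cases hii : i = i₀
      · simpa [hii] using hj₀
      · simpa [hii] using (hne i hi hii).2
    · by_cases hii : i = i₀ <;> by_cases hii' : i' = i₀
      · rw [hii, hii']
      · exact absurd (by simpa [hii, hii'] using h.symm) (hne i' hi' hii').1
      · exact absurd (by simpa [hii, hii'] using h) (hne i hi hii).1
      · simp only [Function.update_of_ne hii, Function.update_of_ne hii'] at h
        exact hinj (by simpa [hii] using hi) (by simpa [hii'] using hi') h
    · by_cases hii : i = i₀
      · exact ⟨t, c, hc, by simpa [hii] using hb⟩
      · simpa [hii] using hσ i (by simp [hi, hii])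

end

theorem Polynomial.finite_support_algebraMap_laurentSeries (p : Polynomial F) :
    (algebraMap (Polynomial F) (LaurentSeries F) p).support.Finite := by
  induction p using Polynomial.induction_on' with
  | add p q hp hq =>
    rw [map_add]
    exact (hp.union hq).subset (HahnSeries.support_add_subset _ _)
  | monomial n c =>
    refine (Set.finite_singleton (n : ℤ)).subset ?_
    rw [← Polynomial.C_mul_X_pow_eq_monomial, Polynomial.algebraMap_hahnSeries_apply]
    simp only [Polynomial.coe_mul, Polynomial.coe_C, Polynomial.coe_pow, Polynomial.coe_X,
      map_mul, HahnSeries.ofPowerSeries_C, HahnSeries.ofPowerSeries_X_pow, HahnSeries.C_apply,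
      HahnSeries.single_mul_single, zero_add]
    exact HahnSeries.support_single_subset

/-- The vectors of finite weight in a Laurent series code. -/
def finiteWeightSubgroup {n : ℕ} (C : Submodule (LaurentSeries F) (Fin n → LaurentSeries F)) :
    AddSubgroup C where
  carrier := {v | ∀ i, ((v : Fin n → LaurentSeries F) i).support.Finite}
  add_mem' := fun hv hw i => ((hv i).union (hw i)).subset (HahnSeries.support_add_subset _ _)
  zero_mem' := fun i => by simp
  neg_mem' := fun hv i => by simpa using hv i

theorem IsLSCode.span_finiteWeightSubgroup {k n : ℕ}
    {C : Submodule (LaurentSeries F) (Fin n → LaurentSeries F)} (hC : IsLSCode k C) :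
    Submodule.span (LaurentSeries F) (finiteWeightSubgroup C : Set C) = ⊤ := by
  obtain ⟨G, -, hG⟩ := hC
  let G' : Matrix (Fin k) (Fin n) (LaurentSeries F) :=
    G.map fun p => algebraMap (Polynomial F) (LaurentSeries F) p
  have hrow : ∀ l, G' l ∈ C := fun l => by
    rw [← SetLike.mem_coe, hG]
    exact ⟨Pi.single l 1, Matrix.single_one_vecMul l G'⟩
  rw [eq_top_iff]
  rintro ⟨v, hv⟩ -
  obtain ⟨u, hu⟩ : v ∈ codeOfLS G := hG ▸ hv
  have : (⟨v, hv⟩ : C) = ∑ l, u l • (⟨G' l, hrow l⟩ : C) := by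
    refine Subtype.ext ?_
    simp only [← hu, Submodule.coe_sum, Submodule.coe_smul]
    exact Matrix.vecMul_eq_sum u G'
  rw [this]
  exact Submodule.sum_mem _ fun l _ => Submodule.smul_mem _ _ <| Submodule.subset_span fun i =>
    Polynomial.finite_support_algebraMap_laurentSeries (G l i)

/-- Every isometry between Laurent series codes is the restriction of a monomial
transformation. -/
theorem exists_perm_eq_single_smul_of_wtL_eq [Finite F] {k n : ℕ}
    {C D : Submodule (LaurentSeries F) (Fin n → LaurentSeries F)} (hC : IsLSCode k C)
    (φ : C ≃ₗ[LaurentSeries F] D)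
    (hφ : ∀ v : C, wtL (φ v : Fin n → LaurentSeries F) = wtL (v : Fin n → LaurentSeries F)) :
    ∃ (σ : Equiv.Perm (Fin n)) (t : Fin n → ℤ) (c : Fin n → F), (∀ i, c i ≠ 0) ∧
      ∀ (v : C) (i : Fin n), (φ v : Fin n → LaurentSeries F) (σ i) =
        (HahnSeries.single (t i) (c i) : LaurentSeries F) • (v : Fin n → LaurentSeries F) i := by
  let a : Fin n → C →ₗ[LaurentSeries F] LaurentSeries F :=
    fun i => LinearMap.proj i ∘ₗ C.subtype
  let b : Fin n → C →ₗ[LaurentSeries F] LaurentSeries F :=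
    fun i => LinearMap.proj i ∘ₗ D.subtype ∘ₗ φ.toLinearMap
  obtain ⟨σ, -, hσ, h⟩ := exists_injOn_eq_single_smul_of_sum_encard_support_eq a b
    (finiteWeightSubgroup C)
    (fun t c v hv i => LaurentSeries.finite_support_single_smul t c (hv i))
    hC.span_finiteWeightSubgroup Finset.univ Finset.univ rfl (fun i _ v hv => hv i)
    (fun v _ => (hφ v).symm)
  choose t c hc h using fun i => h i (Finset.mem_univ i)
  refine ⟨Equiv.ofBijective σ (Finite.injective_iff_bijective.1 ?_), t, c, hc, fun v i =>
    LinearMap.congr_fun (h i) v⟩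
  rwa [Finset.coe_univ, Set.injOn_univ] at hσ

/-- If two Laurent series codes are `R`-isometric then so are their duals. -/
theorem stmt19 {F : Type*} [Field F] [Fintype F] {k n : ℕ}
    (C Cbar : Submodule (LaurentSeries F) (Fin n → LaurentSeries F))
    (hC : IsLSCode k C) (hCbar : IsLSCode k Cbar)
    (h : ∃ φ : C ≃ₗ[LaurentSeries F] Cbar,
      ∀ v : C, wtL ((φ v : Fin n → LaurentSeries F)) = wtL (v : Fin n → LaurentSeries F)) :
    ∃ ψ : dualLS C ≃ₗ[LaurentSeries F] dualLS Cbar,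
      ∀ w : dualLS C,
        wtL ((ψ w : Fin n → LaurentSeries F)) = wtL (w : Fin n → LaurentSeries F) := by
  obtain ⟨φ, hφ⟩ := h
  obtain ⟨σ, t, c, hc, hσ⟩ := exists_perm_eq_single_smul_of_wtL_eq hC φ hφ
  let m : Fin n → LaurentSeries F := fun i => HahnSeries.single (t i) (c i)
  let m' : Fin n → LaurentSeries F := fun i => HahnSeries.single (-t i) (c i)⁻¹
  have hm : ∀ i, m i * m' i = 1 := fun i => by
    simp [m, m', HahnSeries.single_mul_single, hc i]
  let Ψ : (Fin n → LaurentSeries F) ≃ₗ[LaurentSeries F] (Fin n → LaurentSeries F) :=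
    { toFun := fun w j => m' (σ.symm j) * w (σ.symm j)
      invFun := fun w i => m i * w (σ i)
      map_add' := fun v w => by ext1 j; simp [mul_add]
      map_smul' := fun r w => by ext1 j; simp [mul_left_comm]
      left_inv := fun w => by ext1 i; simp [← mul_assoc, hm]
      right_inv := fun w => by ext1 j; simp [← mul_assoc, mul_comm (m' _) (m _), hm] }
  have hΨ : ∀ w i, Ψ w (σ i) = m' i * w i := fun w i => by simp [Ψ]
  have hdot : ∀ (v : C) w, ∑ j, (φ v : Fin n → LaurentSeries F) j * Ψ w j =
      ∑ i, (v : Fin n → LaurentSeries F) i * w i := fun v w => by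
    rw [← Equiv.sum_comp σ]
    refine Finset.sum_congr rfl fun i _ => ?_
    rw [hΨ, hσ, smul_eq_mul]
    linear_combination ((v : Fin n → LaurentSeries F) i * w i) * hm i
  have hdual : dualLS C = (dualLS Cbar).comap Ψ.toLinearMap := by
    ext w
    constructor
    · intro hw v hv
      rw [← hw _ (φ.symm ⟨v, hv⟩).2, ← hdot (φ.symm ⟨v, hv⟩) w, LinearEquiv.apply_symm_apply]
      rfl
    · intro hw v hv
      rw [← hw _ (φ ⟨v, hv⟩).2]
      exact (hdot ⟨v, hv⟩ w).symm
  refine ⟨(LinearEquiv.ofEq _ _ hdual).trans (Ψ.ofSubmodule' (dualLS Cbar)), fun w => ?_⟩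
  change wtL (Ψ w) = _
  rw [wtL, wtL, ← Equiv.sum_comp σ]
  refine Finset.sum_congr rfl fun i _ => ?_
  rw [hΨ, ← smul_eq_mul]
  exact LaurentSeries.encard_support_single_smul _ (inv_ne_zero (hc i)) _
end
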